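/- arXiv:2509.03023 — 2 statements merged into one kernel-verified Lean document; each statement's English description precedes it below -/
import Mathlib

section
/- Let {i,j} = {1,2} and let n, m, k, l ≥ 1 be integers. If the digital pictures (I_{n,m},c_i,c_j) and (I_{k,l},c_i,c_j) are homotopy equivalent, then n + m = k + l. -/
/-- Points of the digital plane. -/
abbrev Pt : Type := ℤ × ℤ

/-- `c_i`-adjacency on `ℤ²` (for `i = 1` or `i = 2`). -/
def cAdj (i : ℕ) (x y : Pt) : Prop :=
  if i = 1 then |x.1 - y.1| + |x.2 - y.2| ≤ 1
  else |x.1 - y.1| ≤ 1 ∧ |x.2 - y.2| ≤ 1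

/-- The adjacency induced on a subset of `ℤ²`. -/
def subAdj (i : ℕ) (X : Set Pt) (x y : X) : Prop := cAdj i x.1 y.1

/-- Digital continuity of a map between digital images. -/
def DigCont {α β : Type} (κ : α → α → Prop) (δ : β → β → Prop) (f : α → β) : Prop :=
  ∀ x y, κ x y → δ (f x) (f y)

/-- The standard (`c_1`) adjacency on `ℕ`, used for digital intervals. -/
def natAdj (s t : ℕ) : Prop := s = t ∨ s + 1 = t ∨ t + 1 = s

/-- The two normal product adjacencies on `α × ℕ`. -/
def prodAdj (i : ℕ) {α : Type} (κ : α → α → Prop) (p q : α × ℕ) : Prop :=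
  if i = 1 then (κ p.1 q.1 ∧ p.2 = q.2) ∨ (p.1 = q.1 ∧ natAdj p.2 q.2)
  else κ p.1 q.1 ∧ natAdj p.2 q.2

/-- `f` and `g` are `i`-homotopic: there is a continuous
`H : X ×_i [0,m]_ℤ → Y` with `H(·,0) = f` and `H(·,m) = g`. -/
def Homotopic (i : ℕ) {α β : Type} (κ : α → α → Prop) (δ : β → β → Prop)
    (f g : α → β) : Prop :=
  ∃ (m : ℕ) (H : α → ℕ → β),
    (∀ x, H x 0 = f x) ∧ (∀ x, H x m = g x) ∧
    (∀ x y s t, s ≤ m → t ≤ m → prodAdj i κ (x, s) (y, t) → δ (H x s) (H y t))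

/-- `i`-homotopy equivalence of digital images. -/
def HtpyEquiv (i : ℕ) {α β : Type} (κ : α → α → Prop) (δ : β → β → Prop) : Prop :=
  ∃ (f : α → β) (g : β → α),
    DigCont κ δ f ∧ DigCont δ κ g ∧
    Homotopic i κ κ (g ∘ f) id ∧ Homotopic i δ δ (f ∘ g) id

/-- Homotopy equivalence of digital pictures `(X, c_i, c_j)` and `(Y, c_i, c_j)`. -/
def PicHtpyEquiv (i j : ℕ) (X Y : Set Pt) : Prop :=
  HtpyEquiv i (subAdj i X) (subAdj i Y) ∧ HtpyEquiv j (subAdj j Xᶜ) (subAdj j Yᶜ)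

/-- Isomorphism of digital images: a continuous bijection with continuous inverse. -/
def DigIso {α β : Type} (κ : α → α → Prop) (δ : β → β → Prop) : Prop :=
  ∃ e : α ≃ β, DigCont κ δ ⇑e ∧ DigCont δ κ ⇑e.symm

/-- Isomorphism of digital pictures. -/
def PicIso (i j : ℕ) (X Y : Set Pt) : Prop :=
  DigIso (subAdj i X) (subAdj i Y) ∧ DigIso (subAdj j Xᶜ) (subAdj j Yᶜ)

/-- `x` and `y` are joined by a `c_i`-path inside `A`. -/
def ChainIn (i : ℕ) (A : Set Pt) (x y : Pt) : Prop :=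
  ∃ (n : ℕ) (c : ℕ → Pt), c 0 = x ∧ c n = y ∧ (∀ k ≤ n, c k ∈ A) ∧
    ∀ k < n, cAdj i (c k) (c (k + 1))

/-- `A` is `c_i`-connected. -/
def Conn (i : ℕ) (A : Set Pt) : Prop := ∀ x ∈ A, ∀ y ∈ A, ChainIn i A x y

/-- The `c_i`-component of `p` in `A`. -/
def compOf (i : ℕ) (A : Set Pt) (p : Pt) : Set Pt := {y | ChainIn i A p y}

/-- The digital picture `(X, c_i, c_j)` has no hole: every `c_j`-component
of the complement of `X` is infinite. -/
def NoHole (j : ℕ) (X : Set Pt) : Prop := ∀ p ∈ Xᶜ, (compOf j Xᶜ p).Infinite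

/-- The row of `X` at height `k`. -/
def rowOf (X : Set Pt) (k : ℤ) : Set Pt := X ∩ {p | p.2 = k}

/-- `r` is a row component of `(X, c_i)`: a `c_i`-component of a row of `X`. -/
def IsRowComp (i : ℕ) (X : Set Pt) (r : Set Pt) : Prop :=
  ∃ (k : ℤ) (p : Pt), p ∈ rowOf X k ∧ r = compOf i (rowOf X k) p

/-- Two subsets of `ℤ²` are `c_i`-adjacent. -/
def setAdj (i : ℕ) (A B : Set Pt) : Prop := ∃ a ∈ A, ∃ b ∈ B, cAdj i a b

/-- The edge relation of the row component graph `R(X, c_i)`: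
two distinct row components joined when they are `c_i`-adjacent. -/
def rcgAdj (i : ℕ) (X : Set Pt) (r s : Set Pt) : Prop :=
  IsRowComp i X r ∧ IsRowComp i X s ∧ r ≠ s ∧ setAdj i r s

/-- The row component graph `R(X, c_i)` is acyclic: there is no cycle of
`k ≥ 3` distinct row components with consecutive ones adjacent. -/
def RCGAcyclic (i : ℕ) (X : Set Pt) : Prop :=
  ¬ ∃ (k : ℕ) (r : ℕ → Set Pt), 3 ≤ k ∧
    (∀ t < k, IsRowComp i X (r t)) ∧
    (∀ t < k, ∀ t' < k, r t = r t' → t = t') ∧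
    (∀ t, t + 1 < k → rcgAdj i X (r t) (r (t + 1))) ∧
    rcgAdj i X (r (k - 1)) (r 0)

/-- The row component graph `R(X, c_i)` is connected. -/
def RCGConnected (i : ℕ) (X : Set Pt) : Prop :=
  ∀ r s : Set Pt, IsRowComp i X r → IsRowComp i X s →
    Relation.ReflTransGen (rcgAdj i X) r s

/-- A digital image is `i`-contractible: the identity is `i`-homotopic to a constant map. -/
def Contractible (i : ℕ) {α : Type} (κ : α → α → Prop) : Prop :=
  ∃ x₀ : α, Homotopic i κ κ id (fun _ => x₀)

/-- Row-convexity. -/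
def RowConvex (X : Set Pt) : Prop :=
  ∀ a b c k : ℤ, (a, k) ∈ X → (c, k) ∈ X → a ≤ b → b ≤ c → (b, k) ∈ X

/-- Column-convexity. -/
def ColConvex (X : Set Pt) : Prop :=
  ∀ a b c k : ℤ, (k, a) ∈ X → (k, c) ∈ X → a ≤ b → b ≤ c → (k, b) ∈ X

/-- The row-convex hull of `X`. -/
def Hr (X : Set Pt) : Set Pt := ⋂₀ {S | RowConvex S ∧ X ⊆ S}

/-- The column-convex hull of `X`. -/
def Hc (X : Set Pt) : Set Pt := ⋂₀ {S | ColConvex S ∧ X ⊆ S}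

/-- The rc-convex hull of `X`. -/
def Hrc (X : Set Pt) : Set Pt := ⋂₀ {S | (RowConvex S ∧ ColConvex S) ∧ X ⊆ S}

/-- A loop of length `m` inside `Z`: a continuous `γ : [0,m]_ℤ → Z` with `γ 0 = γ m`. -/
def LoopIn (j : ℕ) (Z : Set Pt) (m : ℕ) (γ : ℕ → Pt) : Prop :=
  γ 0 = γ m ∧ (∀ t ≤ m, γ t ∈ Z) ∧ ∀ t < m, cAdj j (γ t) (γ (t + 1))

/-- The loop `γ` is `j`-contractible in `Z`: there is a `j`-homotopy in `Z` from `γ`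
to the constant loop at `γ 0` whose every stage is a loop based at `γ 0`. -/
def LoopContractibleIn (j : ℕ) (Z : Set Pt) (m : ℕ) (γ : ℕ → Pt) : Prop :=
  ∃ (K : ℕ) (H : ℕ → ℕ → Pt),
    (∀ t, H t 0 = γ t) ∧ (∀ t, H t K = γ 0) ∧
    (∀ k ≤ K, H 0 k = γ 0 ∧ H m k = γ 0) ∧
    (∀ t ≤ m, ∀ k ≤ K, H t k ∈ Z) ∧
    (∀ s t k l, s ≤ m → t ≤ m → k ≤ K → l ≤ K →
      prodAdj j natAdj (s, k) (t, l) → cAdj j (H s k) (H t l))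

/-- The union of the infinite `c_j`-components of the complement of `X`. -/
def InfPart (j : ℕ) (X : Set Pt) : Set Pt := {p | p ∈ Xᶜ ∧ (compOf j Xᶜ p).Infinite}

/-- The outer perimeter of the digital picture `(X, c_i, c_j)`: the least length of a
non-`j`-contractible loop in the infinite component of the complement of `X`, or `1`
if no such loop exists.  (It depends only on `j` and `X`.) -/
noncomputable def outerPerim (j : ℕ) (X : Set Pt) : ℕ := by
  classical
  exact if (∃ m γ, LoopIn j (InfPart j X) m γ ∧ ¬ LoopContractibleIn j (InfPart j X) m γ)
    then sInf {m | ∃ γ, LoopIn j (InfPart j X) m γ ∧ ¬ LoopContractibleIn j (InfPart j X) m γ}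
    else 1

/-- The digital rectangle `I_{n,m} = [1,n]_ℤ × [1,m]_ℤ`. -/
def Irect (n m : ℤ) : Set Pt := Set.Icc 1 n ×ˢ Set.Icc 1 m

/-- A finite digital image is `i`-reducible when it is `i`-homotopy equivalent to a
digital image with strictly fewer points. -/
def Reducible (i : ℕ) {α : Type} (κ : α → α → Prop) : Prop :=
  ∃ (β : Type) (δ : β → β → Prop), Reflexive δ ∧ Symmetric δ ∧ Finite β ∧
    Nat.card β < Nat.card α ∧ HtpyEquiv i κ δ

/-! ### Winding numbers of cyclic integer sequences -/

/-- `a` and `b` are equal or neighbours in the cycle `ℤ / L`. -/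
def Near (L a b : ℤ) : Prop := L ∣ b - a ∨ L ∣ b - a - 1 ∨ L ∣ b - a + 1

/-- The representative in `{-1, 0, 1}` of the residue class of `d` modulo `L`, if there is one. -/
noncomputable def cycStep (L d : ℤ) : ℤ := by
  classical
  exact if L ∣ d - 1 then 1 else if L ∣ d + 1 then -1 else 0

/-- The total displacement along the first `M` steps of a sequence in `ℤ / L`. -/
noncomputable def wind (L : ℤ) (M : ℕ) (a : ℕ → ℤ) : ℤ :=
  ∑ t ∈ Finset.range M, cycStep L (a (t + 1) - a t)

theorem abs_cycStep_le (L d : ℤ) : |cycStep L d| ≤ 1 := by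
  unfold cycStep
  split_ifs <;> simp

theorem Near.dvd_sub_cycStep {L a b : ℤ} (h : Near L a b) : L ∣ b - a - cycStep L (b - a) := by
  unfold cycStep
  split_ifs with h₁ h₂
  · exact h₁
  · simpa using h₂
  · rcases h with h | h | h
    · simpa using h
    · exact absurd h h₁
    · exact absurd h h₂

theorem cycStep_congr {L d e : ℤ} (h : L ∣ d - e) : cycStep L d = cycStep L e := by
  have h₁ : L ∣ d - 1 ↔ L ∣ e - 1 := by
    rw [show d - 1 = (d - e) + (e - 1) by ring]; exact dvd_add_right h
  have h₂ : L ∣ d + 1 ↔ L ∣ e + 1 := by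
    rw [show d + 1 = (d - e) + (e + 1) by ring]; exact dvd_add_right h
  simp only [cycStep, h₁, h₂]

theorem cycStep_zero {L : ℤ} (hL : 4 ≤ L) : cycStep L 0 = 0 := by
  have h₁ : ¬ L ∣ 0 - 1 := fun h => by
    have := Int.le_of_dvd one_pos ((dvd_neg).1 (by simpa using h)); omega
  have h₂ : ¬ L ∣ 0 + 1 := fun h => by
    have := Int.le_of_dvd one_pos (by simpa using h); omega
  simp only [cycStep, h₁, h₂, if_false]

theorem near_of_abs_sub_le {L a b : ℤ}
    (h : (-1 ≤ b - a ∧ b - a ≤ 1) ∨ (-1 ≤ b - a - L ∧ b - a - L ≤ 1) ∨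
      (-1 ≤ b - a + L ∧ b - a + L ≤ 1)) : Near L a b := by
  have key : ∀ z e : ℤ, b - a = z * L + e → e = 0 ∨ e = 1 ∨ e = -1 → Near L a b := by
    rintro z e h (rfl | rfl | rfl)
    · exact Or.inl ⟨z, by linarith⟩
    · exact Or.inr (Or.inl ⟨z, by linarith⟩)
    · exact Or.inr (Or.inr ⟨z, by linarith⟩)
  rcases h with h | h | h
  · exact key 0 (b - a) (by ring) (by omega)
  · exact key 1 (b - a - L) (by ring) (by omega)
  · exact key (-1) (b - a + L) (by ring) (by omega)

theorem cycStep_add_of_triangle {L a b c : ℤ} (hL : 4 ≤ L) (hab : Near L a b) (hbc : Near L b c)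
    (hac : Near L a c) : cycStep L (b - a) + cycStep L (c - b) = cycStep L (c - a) := by
  have h := dvd_sub hac.dvd_sub_cycStep (dvd_add hab.dvd_sub_cycStep hbc.dvd_sub_cycStep)
  have h₁ := abs_le.1 (abs_cycStep_le L (b - a))
  have h₂ := abs_le.1 (abs_cycStep_le L (c - b))
  have h₃ := abs_le.1 (abs_cycStep_le L (c - a))
  have := Int.eq_zero_of_abs_lt_dvd h (abs_lt.2 ⟨by linarith, by linarith⟩)
  linarith

theorem cycStep_add_of_square {L a b c d : ℤ} (hL : 5 ≤ L) (hab : Near L a b) (hbd : Near L b d)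
    (hac : Near L a c) (hcd : Near L c d) :
    cycStep L (b - a) + cycStep L (d - b) = cycStep L (c - a) + cycStep L (d - c) := by
  have h := dvd_sub (dvd_add hac.dvd_sub_cycStep hcd.dvd_sub_cycStep)
    (dvd_add hab.dvd_sub_cycStep hbd.dvd_sub_cycStep)
  have h₁ := abs_le.1 (abs_cycStep_le L (b - a))
  have h₂ := abs_le.1 (abs_cycStep_le L (d - b))
  have h₃ := abs_le.1 (abs_cycStep_le L (c - a))
  have h₄ := abs_le.1 (abs_cycStep_le L (d - c))
  have := Int.eq_zero_of_abs_lt_dvd h (abs_lt.2 ⟨by linarith, by linarith⟩)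
  linarith

theorem abs_wind_le (L : ℤ) (M : ℕ) (a : ℕ → ℤ) : |wind L M a| ≤ M := by
  refine (Finset.abs_sum_le_sum_abs _ _).trans ?_
  refine (Finset.sum_le_sum fun t _ => abs_cycStep_le L _).trans ?_
  simp

theorem dvd_sub_wind {L : ℤ} {a : ℕ → ℤ} (ha : ∀ t, Near L (a t) (a (t + 1))) (M : ℕ) :
    L ∣ a M - a 0 - wind L M a := by
  induction M with
  | zero => simp [wind]
  | succ M ih =>
    have h : a (M + 1) - a 0 - wind L (M + 1) a = (a M - a 0 - wind L M a) +
        (a (M + 1) - a M - cycStep L (a (M + 1) - a M)) := by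
      rw [wind, wind, Finset.sum_range_succ]
      ring
    exact h ▸ dvd_add ih (ha M).dvd_sub_cycStep

theorem wind_eq_of_near {L : ℤ} {M : ℕ} {a b : ℕ → ℤ} (hL : 4 ≤ L)
    (ha : ∀ t, Near L (a t) (a (t + 1))) (hb : ∀ t, Near L (b t) (b (t + 1)))
    (hab : ∀ t, Near L (a t) (b t)) (hdiag : 5 ≤ L ∨ ∀ t, Near L (a t) (b (t + 1)))
    (haM : a M = a 0) (hbM : b M = b 0) : wind L M a = wind L M b := by
  have h : ∀ t, cycStep L (a (t + 1) - a t) - cycStep L (b (t + 1) - b t) =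
      cycStep L (b t - a t) - cycStep L (b (t + 1) - a (t + 1)) := by
    intro t
    rcases hdiag with hL | hd
    · linarith [cycStep_add_of_square hL (ha t) (hab (t + 1)) (hab t) (hb t)]
    · linarith [cycStep_add_of_triangle hL (ha t) (hab (t + 1)) (hd t),
        cycStep_add_of_triangle hL (hab t) (hb t) (hd t)]
  rw [← sub_eq_zero, wind, wind, ← Finset.sum_sub_distrib, Finset.sum_congr rfl fun t _ => h t,
    Finset.sum_range_sub' (fun t => cycStep L (b t - a t)), haM, hbM, sub_self]

/-! ### Invariance of winding numbers under digital homotopy -/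

theorem prodAdj_refl_right {α : Type} {κ : α → α → Prop} (i : ℕ) {x y : α} (h : κ x y) (s : ℕ) :
    prodAdj i κ (x, s) (y, s) := by
  unfold prodAdj
  split_ifs
  · exact Or.inl ⟨h, rfl⟩
  · exact ⟨h, Or.inl rfl⟩

theorem prodAdj_succ {α : Type} {κ : α → α → Prop} (i : ℕ) {x : α} (h : κ x x) (s : ℕ) :
    prodAdj i κ (x, s) (x, s + 1) := by
  unfold prodAdj
  split_ifs
  · exact Or.inr ⟨rfl, Or.inr (Or.inl rfl)⟩
  · exact ⟨h, Or.inr (Or.inl rfl)⟩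

theorem wind_eq_of_homotopy {α β : Type} {κ : α → α → Prop} {δ : β → β → Prop} {j : ℕ} {L : ℤ}
    (hL : 4 ≤ L) (hL₁ : j = 1 → 5 ≤ L) (hκ : ∀ x, κ x x)
    {Φ : β → ℤ} (hΦ : ∀ x y, δ x y → Near L (Φ x) (Φ y))
    {γ : ℕ → α} {M : ℕ} (hγ : ∀ t, κ (γ t) (γ (t + 1))) (hM : γ M = γ 0)
    {m : ℕ} {H : α → ℕ → β}
    (hH : ∀ x y s t, s ≤ m → t ≤ m → prodAdj j κ (x, s) (y, t) → δ (H x s) (H y t)) :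
    wind L M (fun t => Φ (H (γ t) 0)) = wind L M (fun t => Φ (H (γ t) m)) := by
  suffices ∀ s ≤ m, wind L M (fun t => Φ (H (γ t) 0)) = wind L M (fun t => Φ (H (γ t) s)) from
    this m le_rfl
  intro s
  induction s with
  | zero => intro _; rfl
  | succ s ih =>
    intro hs
    rw [ih (by omega)]
    have hs' : s ≤ m := by omega
    refine wind_eq_of_near hL (fun t => hΦ _ _ (hH _ _ _ _ hs' hs' ?_))
      (fun t => hΦ _ _ (hH _ _ _ _ hs hs ?_)) (fun t => hΦ _ _ (hH _ _ _ _ hs' hs ?_)) ?_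
      (by simp only [hM]) (by simp only [hM])
    · exact prodAdj_refl_right j (hγ t) s
    · exact prodAdj_refl_right j (hγ t) (s + 1)
    · exact prodAdj_succ j (hκ _) s
    · by_cases hj : j = 1
      · exact Or.inl (hL₁ hj)
      · refine Or.inr fun t => hΦ _ _ (hH _ _ _ _ hs' hs ?_)
        rw [prodAdj, if_neg hj]
        exact ⟨hγ t, Or.inr (Or.inl rfl)⟩

/-! ### Adjacency in the digital plane -/

theorem cAdj_one_iff {p q : Pt} : cAdj 1 p q ↔
    p.1 - q.1 + (p.2 - q.2) ≤ 1 ∧ p.1 - q.1 - (p.2 - q.2) ≤ 1 ∧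
    -(p.1 - q.1) + (p.2 - q.2) ≤ 1 ∧ -(p.1 - q.1) - (p.2 - q.2) ≤ 1 := by
  rw [cAdj, if_pos rfl]
  rcases abs_cases (p.1 - q.1) with ⟨h, h'⟩ | ⟨h, h'⟩ <;>
    rcases abs_cases (p.2 - q.2) with ⟨k, k'⟩ | ⟨k, k'⟩ <;> rw [h, k] <;> omega

theorem cAdj_iff_of_ne_one {j : ℕ} (hj : j ≠ 1) {p q : Pt} : cAdj j p q ↔
    (-1 ≤ p.1 - q.1 ∧ p.1 - q.1 ≤ 1) ∧ (-1 ≤ p.2 - q.2 ∧ p.2 - q.2 ≤ 1) := by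
  rw [cAdj, if_neg hj, abs_le, abs_le]

theorem cAdj_refl (j : ℕ) (p : Pt) : cAdj j p p := by
  simp [cAdj]

theorem cAdj_symm {j : ℕ} {p q : Pt} (h : cAdj j p q) : cAdj j q p := by
  unfold cAdj at *
  rwa [abs_sub_comm q.1, abs_sub_comm q.2]

theorem notMem_Irect {n m : ℤ} {p : Pt} :
    p ∉ Irect n m ↔ (p.1 < 1 ∨ n < p.1) ∨ (p.2 < 1 ∨ m < p.2) := by
  simp only [Irect, Set.mem_prod, Set.mem_Icc]
  omega

/-! ### The exterior of a rectangle retracts onto a cycle -/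

/-- The length of the shortest `c_j`-cycle around the rectangle `I_{n,m}`. -/
def cycLen (j : ℕ) (n m : ℤ) : ℤ := 2 * (n + m) + if j = 1 then 4 else 0

/-- Clamp the first coordinate to `[-s, n + 1 + s]` and the second to `[-u, m + 1 + u]`. -/
def clampBox (n m : ℤ) (s u : ℕ) (p : Pt) : Pt :=
  (max (-s) (min p.1 (n + 1 + s)), max (-u) (min p.2 (m + 1 + u)))

theorem clampBox_notMem {n m : ℤ} {s u : ℕ} {p : Pt}
    (hp : p ∉ Irect n m) : clampBox n m s u p ∉ Irect n m := by
  rw [notMem_Irect] at *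
  simp only [clampBox]
  omega

/-- `θ` and `σ` exhibit a cycle of length `cycLen j n m` as a `c_j`-deformation retract of the
frame around `I_{n,m}`. -/
structure IsFrameRetraction (j : ℕ) (n m : ℤ) (θ : Pt → ℤ) (σ : ℤ → Pt) : Prop where
  notMem : ∀ k, σ k ∉ Irect n m
  adj_succ : ∀ k, cAdj j (σ k) (σ (k + 1))
  periodic : ∀ k k', cycLen j n m ∣ k - k' → σ k = σ k'
  near : ∀ p q, p ∉ Irect n m → q ∉ Irect n m → cAdj j p q → Near (cycLen j n m) (θ p) (θ q)
  dvd : ∀ k, cycLen j n m ∣ θ (σ k) - k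
  adj_clamp : ∀ p, p ∉ Irect n m → cAdj j (clampBox n m 0 0 p) (σ (θ p))
  adj_clamp_of_adj : j ≠ 1 → ∀ p q, p ∉ Irect n m → q ∉ Irect n m → cAdj j p q →
    cAdj j (clampBox n m 0 0 p) (σ (θ q)) ∧ cAdj j (σ (θ p)) (clampBox n m 0 0 q)

theorem add_one_emod_cases (k : ℤ) {L : ℤ} (hL : 0 < L) :
    (k + 1) % L = k % L + 1 ∨ (k % L = L - 1 ∧ (k + 1) % L = 0) := by
  have h₀ := Int.emod_nonneg k hL.ne'
  have h₁ := Int.emod_lt_of_pos k hL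
  have h : (k + 1) % L = (k % L + 1) % L := by simp
  by_cases hk : k % L = L - 1
  · right; rw [h, hk]; simp
  · left; rw [h, Int.emod_eq_of_lt (by omega) (by omega)]

theorem emod_cases {k L : ℤ} (h₀ : 0 ≤ k) (h₁ : k ≤ L) (hL : 0 < L) :
    (k % L = k ∧ k < L) ∨ (k = L ∧ k % L = 0) := by
  rcases h₁.lt_or_eq with h | rfl
  · exact Or.inl ⟨Int.emod_eq_of_lt h₀ h, h⟩
  · exact Or.inr ⟨rfl, Int.emod_self⟩

theorem dvd_sub_of_eq_emod {k x L : ℤ} (h : x = k % L ∨ x = k % L + L) : L ∣ x - k := by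
  rcases h with h | h
  · exact ⟨-(k / L), by rw [h, Int.emod_def]; ring⟩
  · exact ⟨1 - k / L, by rw [h, Int.emod_def]; ring⟩

/-- Position of `p` on the `c_1`-frame, counted anticlockwise from the corner `(0,0)`. -/
def framePos₁ (n m : ℤ) (p : Pt) : ℤ :=
  if p.2 ≤ 0 ∨ n + 1 ≤ p.1 then (clampBox n m 0 0 p).1 + (clampBox n m 0 0 p).2
  else 2 * (n + m) + 4 - ((clampBox n m 0 0 p).1 + (clampBox n m 0 0 p).2)

/-- The point of the `c_1`-frame at position `r ∈ [0, 2(n+m)+4)`. -/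
def framePt₁ (n m r : ℤ) : Pt :=
  if r ≤ n + 1 then (r, 0)
  else if r ≤ n + m + 2 then (n + 1, r - n - 1)
  else if r ≤ 2 * n + m + 3 then (2 * n + m + 3 - r, m + 1)
  else (0, 2 * n + 2 * m + 4 - r)

/-- Position of `p` on the `c_2`-frame, counted anticlockwise from `(0,1)`. -/
def framePos₂ (n m : ℤ) (p : Pt) : ℤ :=
  if p.2 ≤ 0 then max 1 (min p.1 n)
  else if n + 1 ≤ p.1 then n + max 1 (min p.2 m)
  else if m + 1 ≤ p.2 then 2 * n + m + 1 - max 1 (min p.1 n)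
  else 2 * n + 2 * m + 1 - max 1 (min p.2 m)

/-- The point of the `c_2`-frame at position `r ∈ [0, 2(n+m))`. -/
def framePt₂ (n m r : ℤ) : Pt :=
  if r ≤ 0 then (0, 1)
  else if r ≤ n then (r, 0)
  else if r ≤ n + m then (n + 1, r - n)
  else if r ≤ 2 * n + m then (2 * n + m + 1 - r, m + 1)
  else (0, 2 * n + 2 * m + 1 - r)

theorem framePt₁_cases (n m r : ℤ) :
    (r ≤ n + 1 ∧ (framePt₁ n m r).1 = r ∧ (framePt₁ n m r).2 = 0) ∨
    (n + 1 < r ∧ r ≤ n + m + 2 ∧ (framePt₁ n m r).1 = n + 1 ∧ (framePt₁ n m r).2 = r - n - 1) ∨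
    (n + m + 2 < r ∧ r ≤ 2 * n + m + 3 ∧ (framePt₁ n m r).1 = 2 * n + m + 3 - r ∧
      (framePt₁ n m r).2 = m + 1) ∨
    ((n + 1 < r ∧ n + m + 2 < r ∧ 2 * n + m + 3 < r) ∧ (framePt₁ n m r).1 = 0 ∧
      (framePt₁ n m r).2 = 2 * n + 2 * m + 4 - r) ∨
    (n < -1 ∨ m < -1) := by
  unfold framePt₁
  split_ifs <;> simp <;> omega

theorem framePt₂_cases (n m r : ℤ) :
    (r ≤ 0 ∧ (framePt₂ n m r).1 = 0 ∧ (framePt₂ n m r).2 = 1) ∨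
    (0 < r ∧ r ≤ n ∧ (framePt₂ n m r).1 = r ∧ (framePt₂ n m r).2 = 0) ∨
    (n < r ∧ r ≤ n + m ∧ (framePt₂ n m r).1 = n + 1 ∧ (framePt₂ n m r).2 = r - n) ∨
    (n + m < r ∧ r ≤ 2 * n + m ∧ (framePt₂ n m r).1 = 2 * n + m + 1 - r ∧
      (framePt₂ n m r).2 = m + 1) ∨
    (2 * n + m < r ∧ (framePt₂ n m r).1 = 0 ∧
      (framePt₂ n m r).2 = 2 * n + 2 * m + 1 - r) := by
  unfold framePt₂
  split_ifs <;> simp <;> omega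

theorem isFrameRetraction_one {n m : ℤ} (hn : 1 ≤ n) (hm : 1 ≤ m) :
    IsFrameRetraction 1 n m (framePos₁ n m)
      (fun k => framePt₁ n m (k % (2 * (n + m) + 4))) := by
  have hL : cycLen 1 n m = 2 * (n + m) + 4 := by simp [cycLen]
  have hL₀ : 0 < 2 * (n + m) + 4 := by omega
  have hr : ∀ k : ℤ, 0 ≤ k % (2 * (n + m) + 4) ∧ k % (2 * (n + m) + 4) < 2 * (n + m) + 4 :=
    fun k => ⟨Int.emod_nonneg k hL₀.ne', Int.emod_lt_of_pos k hL₀⟩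
  refine ⟨fun k => ?_, fun k => ?_, fun k k' h => ?_, fun p q hp hq h => ?_, fun k => ?_,
    fun p hp => ?_, fun h => absurd rfl h⟩
  · rw [notMem_Irect]
    have := framePt₁_cases n m (k % (2 * (n + m) + 4))
    have := hr k
    omega
  · rw [cAdj_one_iff]
    have := framePt₁_cases n m (k % (2 * (n + m) + 4))
    have := framePt₁_cases n m ((k + 1) % (2 * (n + m) + 4))
    have := hr k
    have := add_one_emod_cases k hL₀
    omega
  · rw [hL] at h
    exact congrArg _ (Int.emod_eq_emod_iff_emod_sub_eq_zero.2 (Int.emod_eq_zero_of_dvd h))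
  · rw [hL]
    apply near_of_abs_sub_le
    rw [cAdj_one_iff] at h
    rw [notMem_Irect] at hp hq
    simp only [framePos₁, clampBox, Nat.cast_zero]
    split_ifs <;> omega
  · rw [hL]
    apply dvd_sub_of_eq_emod
    have := framePt₁_cases n m (k % (2 * (n + m) + 4))
    have := hr k
    simp only [framePos₁, clampBox, Nat.cast_zero]
    split_ifs <;> omega
  · rw [cAdj_one_iff]
    rw [notMem_Irect] at hp
    have h₀ : 0 ≤ framePos₁ n m p ∧ framePos₁ n m p ≤ 2 * (n + m) + 4 := by
      simp only [framePos₁, clampBox, Nat.cast_zero]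
      split_ifs <;> omega
    have := framePt₁_cases n m (framePos₁ n m p % (2 * (n + m) + 4))
    have := emod_cases h₀.1 h₀.2 hL₀
    generalize framePos₁ n m p % (2 * (n + m) + 4) = r at *
    simp only [framePos₁, clampBox, Nat.cast_zero] at *
    split_ifs at * <;> omega

theorem isFrameRetraction_of_ne_one {j : ℕ} (hj : j ≠ 1) {n m : ℤ} (hn : 1 ≤ n) (hm : 1 ≤ m) :
    IsFrameRetraction j n m (framePos₂ n m) (fun k => framePt₂ n m (k % (2 * (n + m)))) := by
  have hL : cycLen j n m = 2 * (n + m) := by simp [cycLen, hj]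
  have hL₀ : 0 < 2 * (n + m) := by omega
  have hr : ∀ k : ℤ, 0 ≤ k % (2 * (n + m)) ∧ k % (2 * (n + m)) < 2 * (n + m) :=
    fun k => ⟨Int.emod_nonneg k hL₀.ne', Int.emod_lt_of_pos k hL₀⟩
  have hpos : ∀ p, 0 ≤ framePos₂ n m p ∧ framePos₂ n m p ≤ 2 * (n + m) := fun p => by
    unfold framePos₂
    split_ifs <;> omega
  have hclamp : ∀ p q, p ∉ Irect n m → q ∉ Irect n m → cAdj j p q →
      cAdj j (clampBox n m 0 0 p) (framePt₂ n m (framePos₂ n m q % (2 * (n + m)))) := by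
    intro p q hp hq h
    rw [cAdj_iff_of_ne_one hj] at *
    rw [notMem_Irect] at hp hq
    have := framePt₂_cases n m (framePos₂ n m q % (2 * (n + m)))
    have := emod_cases (hpos q).1 (hpos q).2 hL₀
    generalize framePos₂ n m q % (2 * (n + m)) = r at *
    simp only [framePos₂, clampBox, Nat.cast_zero] at *
    split_ifs at * <;> omega
  refine ⟨fun k => ?_, fun k => ?_, fun k k' h => ?_, fun p q hp hq h => ?_, fun k => ?_,
    fun p hp => hclamp p p hp hp (cAdj_refl j p), fun _ p q hp hq h =>
      ⟨hclamp p q hp hq h, cAdj_symm (hclamp q p hq hp (cAdj_symm h))⟩⟩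
  · rw [notMem_Irect]
    have := framePt₂_cases n m (k % (2 * (n + m)))
    have := hr k
    omega
  · rw [cAdj_iff_of_ne_one hj]
    have := framePt₂_cases n m (k % (2 * (n + m)))
    have := framePt₂_cases n m ((k + 1) % (2 * (n + m)))
    have := hr k
    have := add_one_emod_cases k hL₀
    omega
  · rw [hL] at h
    exact congrArg _ (Int.emod_eq_emod_iff_emod_sub_eq_zero.2 (Int.emod_eq_zero_of_dvd h))
  · rw [hL]
    apply near_of_abs_sub_le
    rw [cAdj_iff_of_ne_one hj] at h
    rw [notMem_Irect] at hp hq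
    simp only [framePos₂]
    split_ifs <;> omega
  · rw [hL]
    apply dvd_sub_of_eq_emod
    have := framePt₂_cases n m (k % (2 * (n + m)))
    have := hr k
    simp only [framePos₂]
    split_ifs <;> omega

theorem exists_isFrameRetraction (j : ℕ) {n m : ℤ} (hn : 1 ≤ n) (hm : 1 ≤ m) :
    ∃ θ σ, IsFrameRetraction j n m θ σ := by
  by_cases hj : j = 1
  · exact ⟨_, _, hj ▸ isFrameRetraction_one hn hm⟩
  · exact ⟨_, _, isFrameRetraction_of_ne_one hj hn hm⟩

theorem four_le_cycLen (j : ℕ) {n m : ℤ} (hn : 1 ≤ n) (hm : 1 ≤ m) : 4 ≤ cycLen j n m := by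
  unfold cycLen
  split_ifs <;> omega

theorem five_le_cycLen {j : ℕ} {n m : ℤ} (hn : 1 ≤ n) (hm : 1 ≤ m) (hj : j = 1) :
    5 ≤ cycLen j n m := by
  rw [cycLen, if_pos hj]
  omega

/-! ### Short loops in the exterior of a rectangle -/

theorem prodAdj_clamp_fst {j : ℕ} {n m : ℤ} {p q : Pt} {s t u : ℕ} (hn : 1 ≤ n) (hm : 1 ≤ m)
    (h : prodAdj j (cAdj j) (p, s) (q, t)) :
    cAdj j (clampBox n m s u p) (clampBox n m t u q) := by
  by_cases hj : j = 1
  · subst hj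
    rw [cAdj_one_iff]
    simp only [prodAdj, if_true, cAdj_one_iff, natAdj] at h
    simp only [clampBox]
    rcases h with ⟨h, rfl⟩ | ⟨rfl, h⟩ <;> omega
  · rw [cAdj_iff_of_ne_one hj]
    simp only [prodAdj, if_neg hj, cAdj_iff_of_ne_one hj, natAdj] at h
    simp only [clampBox]
    omega

theorem prodAdj_clamp_snd {j : ℕ} {n m : ℤ} {p q : Pt} {s t u : ℕ} (hn : 1 ≤ n) (hm : 1 ≤ m)
    (h : prodAdj j (cAdj j) (p, s) (q, t)) :
    cAdj j (clampBox n m u s p) (clampBox n m u t q) := by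
  by_cases hj : j = 1
  · subst hj
    rw [cAdj_one_iff]
    simp only [prodAdj, if_true, cAdj_one_iff, natAdj] at h
    simp only [clampBox]
    rcases h with ⟨h, rfl⟩ | ⟨rfl, h⟩ <;> omega
  · rw [cAdj_iff_of_ne_one hj]
    simp only [prodAdj, if_neg hj, cAdj_iff_of_ne_one hj, natAdj] at h
    simp only [clampBox]
    omega

theorem clampBox_eq_self {n m : ℤ} (hn : 1 ≤ n) (hm : 1 ≤ m) {N : ℕ} {p : Pt}
    (h₁ : p.1.natAbs ≤ N) (h₂ : p.2.natAbs ≤ N) : clampBox n m N N p = p := by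
  ext <;> simp only [clampBox] <;> omega

theorem IsFrameRetraction.adj_of_abs_sub_le {j : ℕ} {n m : ℤ} {θ : Pt → ℤ} {σ : ℤ → Pt}
    (hσ : IsFrameRetraction j n m θ σ) {a b : ℤ} (h : |a - b| ≤ 1) : cAdj j (σ a) (σ b) := by
  rw [abs_le] at h
  obtain h | h | h : b = a ∨ b = a + 1 ∨ a = b + 1 := by omega
  · exact h ▸ cAdj_refl j _
  · exact h ▸ hσ.adj_succ a
  · exact h ▸ cAdj_symm (hσ.adj_succ b)

theorem wind_congr {L : ℤ} {M : ℕ} {a b : ℕ → ℤ} (h : ∀ t ≤ M, a t = b t) :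
    wind L M a = wind L M b := by
  refine Finset.sum_congr rfl fun t ht => ?_
  rw [Finset.mem_range] at ht
  rw [h t ht.le, h (t + 1) ht]

theorem prodAdj.val {j : ℕ} {A : Set Pt} {x y : A} {s t : ℕ}
    (h : prodAdj j (subAdj j A) (x, s) (y, t)) : prodAdj j (cAdj j) (x.1, s) (y.1, t) := by
  unfold prodAdj at *
  split_ifs at *
  · exact h.imp_right fun h => ⟨congrArg Subtype.val h.1, h.2⟩
  · exact h

section ShortLoop

variable {j : ℕ} {n m L : ℤ} {Φ : ↥(Irect n m)ᶜ → ℤ} {γ : ℕ → ↥(Irect n m)ᶜ} {M : ℕ}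

theorem wind_eq_wind_clampBox (hn : 1 ≤ n) (hm : 1 ≤ m) (hL : 4 ≤ L) (hL₁ : j = 1 → 5 ≤ L)
    (hΦ : ∀ x y, subAdj j (Irect n m)ᶜ x y → Near L (Φ x) (Φ y))
    (hγ : ∀ t, subAdj j (Irect n m)ᶜ (γ t) (γ (t + 1))) (hM : γ M = γ 0) :
    wind L M (fun t => Φ (γ t)) =
      wind L M (fun t => Φ ⟨clampBox n m 0 0 (γ t).1, clampBox_notMem (γ t).2⟩) := by
  obtain ⟨N, hN⟩ : ∃ N : ℕ, ∀ t ≤ M, (γ t).1.1.natAbs ≤ N ∧ (γ t).1.2.natAbs ≤ N := by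
    refine ⟨∑ t ∈ Finset.range (M + 1), ((γ t).1.1.natAbs + (γ t).1.2.natAbs), fun t ht => ?_⟩
    have := Finset.single_le_sum (f := fun t => (γ t).1.1.natAbs + (γ t).1.2.natAbs)
      (fun _ _ => Nat.zero_le _) (Finset.mem_range.2 (Nat.lt_add_one_of_le ht))
    omega
  have h₁ := wind_eq_of_homotopy (κ := subAdj j (Irect n m)ᶜ) hL hL₁ (fun x => cAdj_refl j x.1)
    hΦ hγ hM (m := N) (H := fun p s => ⟨clampBox n m s 0 p.1, clampBox_notMem p.2⟩)
    (fun x y s t _ _ h => prodAdj_clamp_fst hn hm h.val)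
  have h₂ := wind_eq_of_homotopy (κ := subAdj j (Irect n m)ᶜ) hL hL₁ (fun x => cAdj_refl j x.1)
    hΦ hγ hM (m := N) (H := fun p s => ⟨clampBox n m N s p.1, clampBox_notMem p.2⟩)
    (fun x y s t _ _ h => prodAdj_clamp_snd hn hm h.val)
  rw [h₁, h₂]
  refine wind_congr fun t ht => congrArg Φ (Subtype.ext ?_)
  exact (clampBox_eq_self hn hm (hN t ht).1 (hN t ht).2).symm

theorem wind_clampBox_eq_wind_frame (hn : 1 ≤ n) (hm : 1 ≤ m) (hL : 4 ≤ L) (hL₁ : j = 1 → 5 ≤ L)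
    {θ : Pt → ℤ} {σ : ℤ → Pt}
    (hσ : IsFrameRetraction j n m θ σ)
    (hΦ : ∀ x y, subAdj j (Irect n m)ᶜ x y → Near L (Φ x) (Φ y))
    (hγ : ∀ t, subAdj j (Irect n m)ᶜ (γ t) (γ (t + 1))) (hM : γ M = γ 0) :
    wind L M (fun t => Φ ⟨clampBox n m 0 0 (γ t).1, clampBox_notMem (γ t).2⟩) =
      wind L M (fun t => Φ ⟨σ (θ (γ t).1), hσ.notMem _⟩) := by
  have hθσ : ∀ x y, subAdj j (Irect n m)ᶜ x y → cAdj j (σ (θ x.1)) (σ (θ y.1)) := by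
    intro x y h
    obtain ⟨e, he, hd⟩ : ∃ e, |e| ≤ 1 ∧ cycLen j n m ∣ θ y.1 - (θ x.1 + e) :=
      ⟨_, abs_cycStep_le _ _, by
        rw [← sub_sub]; exact (hσ.near _ _ x.2 y.2 h).dvd_sub_cycStep⟩
    rw [hσ.periodic _ _ hd]
    exact hσ.adj_of_abs_sub_le (by simpa using he)
  have h := wind_eq_of_homotopy (κ := subAdj j (Irect n m)ᶜ) (δ := subAdj j (Irect n m)ᶜ) hL hL₁
    (fun x => cAdj_refl j x.1) hΦ hγ hM (m := 1)
    (H := fun p s => if s = 0 then ⟨clampBox n m 0 0 p.1, clampBox_notMem p.2⟩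
      else ⟨σ (θ p.1), hσ.notMem _⟩) ?_
  · simpa using h
  · intro x y s t hs ht h
    have hxy : subAdj j (Irect n m)ᶜ x y := by
      unfold prodAdj at h
      split_ifs at h
      · rcases h with ⟨h, -⟩ | ⟨h, -⟩
        · exact h
        · simp only at h
          exact h ▸ cAdj_refl j _
      · exact h.1
    have hne : s ≠ t → j = 1 → x = y := by
      rintro hst rfl
      rcases h with ⟨-, h⟩ | ⟨h, -⟩
      · exact absurd h hst
      · exact h
    have hdiag : s ≠ t → cAdj j (clampBox n m 0 0 x.1) (σ (θ y.1)) ∧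
        cAdj j (σ (θ x.1)) (clampBox n m 0 0 y.1) := by
      intro hst
      by_cases hj : j = 1
      · rw [hne hst hj]
        exact ⟨hσ.adj_clamp _ y.2, cAdj_symm (hσ.adj_clamp _ y.2)⟩
      · exact hσ.adj_clamp_of_adj hj _ _ x.2 y.2 hxy
    obtain rfl | rfl : s = 0 ∨ s = 1 := by omega
    all_goals obtain rfl | rfl : t = 0 ∨ t = 1 := by omega
    · simpa [subAdj] using prodAdj_clamp_fst hn hm (prodAdj_refl_right j hxy 0).val
    · simpa [subAdj] using (hdiag (by simp)).1
    · simpa [subAdj] using (hdiag (by simp)).2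
    · simpa [subAdj] using hθσ x y hxy

theorem wind_frame_eq_zero (hL : 4 ≤ L) (hL₁ : j = 1 → 5 ≤ L)
    {θ : Pt → ℤ} {σ : ℤ → Pt}
    (hσ : IsFrameRetraction j n m θ σ)
    (hΦ : ∀ x y, subAdj j (Irect n m)ᶜ x y → Near L (Φ x) (Φ y))
    {a : ℕ → ℤ} (ha : ∀ t, |a t - a (t + 1)| ≤ 1) (hM : a M = a 0) :
    wind L M (fun t => Φ ⟨σ (a t), hσ.notMem _⟩) = 0 := by
  have hB : ∀ t ≤ M, |a t| ≤ ((a 0).natAbs + M : ℕ) := by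
    suffices ∀ t : ℕ, |a t| ≤ ((a 0).natAbs + t : ℕ) from
      fun t ht => (this t).trans (by push_cast; linarith [Int.ofNat_le.2 ht])
    intro t
    induction t with
    | zero => simp
    | succ t ih =>
      have h := abs_le.1 (ha t)
      rw [abs_le] at *
      omega
  have h := wind_eq_of_homotopy (κ := fun a b : ℤ => |a - b| ≤ 1) (δ := subAdj j (Irect n m)ᶜ)
    hL hL₁ (by simp) hΦ ha hM (m := (a 0).natAbs + M)
    (H := fun z s => ⟨σ (max (-s) (min z s)), hσ.notMem _⟩) ?_
  · refine (wind_congr fun t ht => congrArg Φ (Subtype.ext (congrArg σ ?_))).trans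
      (h.symm.trans ?_)
    · have := abs_le.1 (hB t ht)
      omega
    · have hz : ∀ z : ℤ, max (-((0 : ℕ) : ℤ)) (min z (0 : ℕ)) = 0 := by omega
      simp only [wind, hz, sub_self, cycStep_zero hL, Finset.sum_const_zero]
  · intro x y s t _ _ h
    refine hσ.adj_of_abs_sub_le ?_
    have h' : |x - y| ≤ 1 ∧ natAdj s t := by
      unfold prodAdj at h
      split_ifs at h
      · rcases h with ⟨h, h'⟩ | ⟨h, h'⟩
        · exact ⟨h, Or.inl h'⟩
        · simp only at h
          exact ⟨by simp [h], h'⟩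
      · exact h
    simp only [natAdj, abs_le] at *
    omega

/-- Loops shorter than `cycLen j n m` in the exterior of `I_{n,m}` are null-homotopic, as seen by
maps to a cycle. -/
theorem wind_eq_zero_of_lt_cycLen (hn : 1 ≤ n) (hm : 1 ≤ m) (hL : 4 ≤ L) (hL₁ : j = 1 → 5 ≤ L)
    (hΦ : ∀ x y, subAdj j (Irect n m)ᶜ x y → Near L (Φ x) (Φ y))
    (hγ : ∀ t, subAdj j (Irect n m)ᶜ (γ t) (γ (t + 1))) (hM : γ M = γ 0)
    (hlt : (M : ℤ) < cycLen j n m) : wind L M (fun t => Φ (γ t)) = 0 := by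
  obtain ⟨θ, σ, hσ⟩ := exists_isFrameRetraction j hn hm
  have hθ : ∀ t, Near (cycLen j n m) (θ (γ t).1) (θ (γ (t + 1)).1) :=
    fun t => hσ.near _ _ (γ t).2 (γ (t + 1)).2 (hγ t)
  rw [wind_eq_wind_clampBox hn hm hL hL₁ hΦ hγ hM,
    wind_clampBox_eq_wind_frame hn hm hL hL₁ hσ hΦ hγ hM]
  set w : ℕ → ℤ := fun t => wind (cycLen j n m) t (fun t => θ (γ t).1) with hw
  have hdvd : ∀ t, cycLen j n m ∣ θ (γ t).1 - (θ (γ 0).1 + w t) := fun t => by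
    rw [← sub_sub]
    exact dvd_sub_wind hθ t
  have hwM : w M = 0 := by
    refine Int.eq_zero_of_abs_lt_dvd ?_ ((abs_wind_le _ _ _).trans_lt hlt)
    simpa [hM] using hdvd M
  have h := wind_frame_eq_zero (M := M) hL hL₁ hσ hΦ (a := fun t => θ (γ 0).1 + w t)
    (fun t => ?_) (by simp only [hwM]; simp [hw, wind])
  · rw [← h]
    exact wind_congr fun t _ => congrArg Φ (Subtype.ext (hσ.periodic _ _ (hdvd t)))
  · have : w (t + 1) = w t + cycStep _ (θ (γ (t + 1)).1 - θ (γ t).1) := Finset.sum_range_succ _ _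
    rw [this, abs_sub_comm, add_sub_add_left_eq_sub, add_sub_cancel_left]
    exact abs_cycStep_le _ _

end ShortLoop

theorem cycLen_le_of_htpyEquiv {j : ℕ} {n m k l : ℤ} (hn : 1 ≤ n) (hm : 1 ≤ m) (hk : 1 ≤ k)
    (hl : 1 ≤ l) (h : HtpyEquiv j (subAdj j (Irect n m)ᶜ) (subAdj j (Irect k l)ᶜ)) :
    cycLen j n m ≤ cycLen j k l := by
  by_contra! hlt
  obtain ⟨f, g, hf, hg, -, N, H, hH₀, hH₁, hH⟩ := h
  obtain ⟨θ, σ, hσ⟩ := exists_isFrameRetraction j hk hl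
  have hL := four_le_cycLen j hk hl
  have hL₁ : j = 1 → 5 ≤ cycLen j k l := five_le_cycLen hk hl
  obtain ⟨M, hM⟩ := Int.eq_ofNat_of_zero_le (by omega : 0 ≤ cycLen j k l)
  let δ : ℕ → ↥(Irect k l)ᶜ := fun t => ⟨σ t, hσ.notMem _⟩
  have hδ : ∀ t, subAdj j (Irect k l)ᶜ (δ t) (δ (t + 1)) := fun t => by
    simpa [subAdj, δ] using hσ.adj_succ t
  have hδM : δ M = δ 0 := Subtype.ext (hσ.periodic _ _ (by simp [hM]))
  have hθ : ∀ x y, subAdj j (Irect k l)ᶜ x y → Near (cycLen j k l) (θ x.1) (θ y.1) :=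
    fun x y hxy => hσ.near _ _ x.2 y.2 hxy
  have h₁ := wind_eq_of_homotopy hL hL₁ (fun x => cAdj_refl j x.1) hθ hδ hδM hH
  have h₂ := wind_eq_zero_of_lt_cycLen (Φ := fun x => θ (f x).1) (γ := fun t => g (δ t)) (M := M)
    hn hm hL hL₁ (fun x y hxy => hθ _ _ (hf _ _ hxy)) (fun t => hg _ _ (hδ t))
    (congrArg g hδM) (hM ▸ hlt)
  simp only [hH₀, hH₁, Function.comp_apply, id_eq] at h₁
  rw [h₂] at h₁
  have h₃ : wind (cycLen j k l) M (fun t => θ (δ t).1) = M := by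
    have : ∀ t : ℕ, cycStep (cycLen j k l) (θ (δ (t + 1)).1 - θ (δ t).1) = 1 := fun t => by
      rw [cycStep, if_pos]
      have e : θ (δ (t + 1)).1 - θ (δ t).1 - 1 =
          θ (σ (t + 1)) - (t + 1) - (θ (σ t) - t) := by
        simp only [δ, Nat.cast_add, Nat.cast_one]
        ring
      exact e ▸ dvd_sub (hσ.dvd (t + 1)) (hσ.dvd t)
    simp [wind, this]
  omega

theorem HtpyEquiv.symm {i : ℕ} {α β : Type} {κ : α → α → Prop} {δ : β → β → Prop}
    (h : HtpyEquiv i κ δ) : HtpyEquiv i δ κ :=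
  let ⟨f, g, hf, hg, hgf, hfg⟩ := h
  ⟨g, f, hg, hf, hfg, hgf⟩

/-- homotopy equivalent digital rectangles have the same perimeter. -/
theorem stmt5 (i j : ℕ) (hij : (i = 1 ∧ j = 2) ∨ (i = 2 ∧ j = 1))
    (n m k l : ℤ) (hn : 1 ≤ n) (hm : 1 ≤ m) (hk : 1 ≤ k) (hl : 1 ≤ l)
    (h : PicHtpyEquiv i j (Irect n m) (Irect k l)) :
    n + m = k + l := by
  have h₁ := cycLen_le_of_htpyEquiv hn hm hk hl h.2
  have h₂ := cycLen_le_of_htpyEquiv hk hl hn hm (HtpyEquiv.symm h.2)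
  unfold cycLen at *
  omega
end

section
/- Let X ⊆ ℤ² be a finite nonempty set and i ∈ {1,2}. If the row component graph R(X,c_i) is a tree (connected and acyclic), then (X,c_i) is i-contractible. -/
theorem cAdj_one_iff_s9 (x y : Pt) : cAdj 1 x y ↔
    (-1 ≤ (x.1 - y.1) + (x.2 - y.2) ∧ (x.1 - y.1) + (x.2 - y.2) ≤ 1) ∧
      -1 ≤ (x.1 - y.1) - (x.2 - y.2) ∧ (x.1 - y.1) - (x.2 - y.2) ≤ 1 := by
  simp only [cAdj, if_true]
  rcases abs_cases (x.1 - y.1) with h | h <;> rcases abs_cases (x.2 - y.2) with h' | h' <;> omega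

theorem cAdj_two_iff (x y : Pt) : cAdj 2 x y ↔
    (-1 ≤ x.1 - y.1 ∧ x.1 - y.1 ≤ 1) ∧ -1 ≤ x.2 - y.2 ∧ x.2 - y.2 ≤ 1 := by
  simp [cAdj, abs_le]

theorem cAdj_refl_s9 {i : ℕ} (x : Pt) : cAdj i x x := by
  simp [cAdj]

theorem cAdj_symm_s9 {i : ℕ} {x y : Pt} (h : cAdj i x y) : cAdj i y x := by
  simpa only [cAdj, abs_sub_comm] using h

theorem cAdj_of_snd_eq {i : ℕ} {x y : Pt} (h : x.2 = y.2) :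
    cAdj i x y ↔ -1 ≤ x.1 - y.1 ∧ x.1 - y.1 ≤ 1 := by
  simp [cAdj, h, abs_le]

theorem natAdj_symm {s t : ℕ} (h : natAdj s t) : natAdj t s := by
  unfold natAdj at *
  omega

theorem prodAdj_symm {i : ℕ} {α : Type} {κ : α → α → Prop} (hκ : ∀ x y, κ x y → κ y x)
    {p q : α × ℕ} (h : prodAdj i κ p q) : prodAdj i κ q p := by
  unfold prodAdj at *
  split_ifs at * with hi
  · exact h.imp (fun h => ⟨hκ _ _ h.1, h.2.symm⟩) fun h => ⟨h.1.symm, natAdj_symm h.2⟩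
  · exact ⟨hκ _ _ h.1, natAdj_symm h.2⟩

/-- A digital image deforms in one step onto a contractible subset through a continuous map that
is homotopic to the identity in one step. -/
theorem contractible_of_step {i : ℕ} {X Y : Set Pt} (hYX : Y ⊆ X) (f : Pt → Pt)
    (hf : ∀ x ∈ X, f x ∈ Y)
    (hcont : ∀ x ∈ X, ∀ y ∈ X, cAdj i x y → cAdj i (f x) (f y))
    (hmove : ∀ x ∈ X, cAdj i x (f x))
    (hstrong : i ≠ 1 → ∀ x ∈ X, ∀ y ∈ X, cAdj i x y → cAdj i x (f y))
    (hY : Contractible i (subAdj i Y)) : Contractible i (subAdj i X) := by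
  obtain ⟨x₀, m, H, h0, hm, hH⟩ := hY
  set F : X → Y := fun x => ⟨f x.1, hf _ x.2⟩
  refine ⟨⟨x₀.1, hYX x₀.2⟩, m + 1,
    fun x t => Nat.casesOn t x fun t => ⟨(H (F x) t).1, hYX (H (F x) t).2⟩,
    fun x => rfl, fun x => by simp [hm], ?_⟩
  have hF0 : ∀ x, (H (F x) 0).1 = f x.1 := fun x => by rw [h0]; rfl
  have hprod : ∀ (x y : X) (s t : ℕ), prodAdj i (subAdj i X) (x, s + 1) (y, t + 1) →
      prodAdj i (subAdj i Y) (F x, s) (F y, t) := by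
    intro x y s t h
    unfold prodAdj natAdj at *
    split_ifs at * with hi
    · rcases h with h | h
      · exact Or.inl ⟨hcont _ x.2 _ y.2 h.1, by simpa using h.2⟩
      · refine Or.inr ⟨congrArg F h.1, ?_⟩
        have := h.2
        dsimp only at *
        omega
    · refine ⟨hcont _ x.2 _ y.2 h.1, ?_⟩
      have := h.2
      dsimp only at *
      omega
  have hzero : ∀ (x y : X) (t : ℕ), prodAdj i (subAdj i X) (x, 0) (y, t + 1) →
      t = 0 ∧ cAdj i x.1 (f y.1) := by
    intro x y t h
    unfold prodAdj at h
    split_ifs at h with hi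
    · rcases h with h | h
      · simp at h
      · have h1 : x = y := h.1
        have h2 : natAdj 0 (t + 1) := h.2
        exact ⟨by unfold natAdj at h2; omega, h1 ▸ hmove _ x.2⟩
    · have h2 : natAdj 0 (t + 1) := h.2
      exact ⟨by unfold natAdj at h2; omega, hstrong hi _ x.2 _ y.2 h.1⟩
  rintro x y (_ | s) (_ | t) hs ht h
  · unfold prodAdj at h
    split_ifs at h with hi
    · rcases h with h | h
      · exact h.1
      · have h1 : x = y := h.1
        subst h1
        exact cAdj_refl_s9 _
    · exact h.1
  · obtain ⟨rfl, h⟩ := hzero x y t h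
    change cAdj i x.1 (H (F y) 0).1
    rwa [hF0]
  · obtain ⟨rfl, h'⟩ := hzero y x s (prodAdj_symm (fun _ _ => cAdj_symm_s9) h)
    change cAdj i (H (F x) 0).1 y.1
    rw [hF0]
    exact cAdj_symm_s9 h'
  · exact hH _ _ _ _ (by omega) (by omega) (hprod x y s t h)

theorem contractible_insert {i : ℕ} {Z : Set Pt} {p q : Pt} (hq : q ∈ Z)
    (hpq : cAdj i p q) (hp : ∀ z ∈ Z, cAdj i z p → cAdj i z q)
    (hZ : Contractible i (subAdj i Z)) : Contractible i (subAdj i (insert p Z)) := by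
  classical
  by_cases hpZ : p ∈ Z
  · rwa [Set.insert_eq_of_mem hpZ]
  have hne : ∀ z ∈ Z, z ≠ p := fun z hz h => hpZ (h ▸ hz)
  have key : ∀ x ∈ insert p Z, ∀ y ∈ insert p Z, cAdj i x y →
      cAdj i x (if y = p then q else y) := by
    rintro x hx y (rfl | hy) h
    · rw [if_pos rfl]
      rcases hx with rfl | hx
      · exact hpq
      · exact hp x hx h
    · rwa [if_neg (hne y hy)]
  have hmem : ∀ x ∈ insert p Z, (if x = p then q else x) ∈ Z := by
    rintro x (rfl | hx)
    · rwa [if_pos rfl]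
    · rwa [if_neg (hne x hx)]
  refine contractible_of_step (Set.subset_insert p Z) (fun x => if x = p then q else x)
    hmem ?_ (fun x hx => key x hx x hx (cAdj_refl_s9 x)) (fun _ => key) hZ
  intro x hx y hy h
  exact cAdj_symm_s9 (key _ (Set.mem_insert_of_mem _ (hmem y hy)) x hx (cAdj_symm_s9 (key x hx y hy h)))

/-- The horizontal digital segment `[a, b]_ℤ × {k}`. -/
def hseg (k a b : ℤ) : Set Pt := {p | p.2 = k ∧ a ≤ p.1 ∧ p.1 ≤ b}

theorem insert_left_hseg {k a b : ℤ} (h : a ≤ b) :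
    insert ((a, k) : Pt) (hseg k (a + 1) b) = hseg k a b := by
  ext ⟨x, y⟩
  simp only [hseg, Set.mem_insert_iff, Set.mem_ofPred_eq, Prod.mk.injEq]
  omega

theorem insert_right_hseg {k a b : ℤ} (h : a ≤ b) :
    insert ((b, k) : Pt) (hseg k a (b - 1)) = hseg k a b := by
  ext ⟨x, y⟩
  simp only [hseg, Set.mem_insert_iff, Set.mem_ofPred_eq, Prod.mk.injEq]
  omega

theorem contractible_hseg_union_of_left {i : ℕ} {k a b : ℤ} {Y : Set Pt} (hab : a < b)
    (hY : ∀ y ∈ Y, ¬ cAdj i y (a, k))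
    (h : Contractible i (subAdj i (hseg k (a + 1) b ∪ Y))) :
    Contractible i (subAdj i (hseg k a b ∪ Y)) := by
  rw [← insert_left_hseg hab.le, Set.insert_union]
  refine contractible_insert (q := (a + 1, k)) (Or.inl ?_) ?_ ?_ h
  · simp only [hseg, Set.mem_ofPred_eq, true_and]
    omega
  · rw [cAdj_of_snd_eq (by rfl)]
    dsimp only
    omega
  · rintro z (hz | hz) hza
    · obtain ⟨h1, h2, h3⟩ := hz
      rw [cAdj_of_snd_eq h1] at hza ⊢
      dsimp only at *
      omega
    · exact absurd hza (hY z hz)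

theorem contractible_hseg_union_of_right {i : ℕ} {k a b : ℤ} {Y : Set Pt} (hab : a < b)
    (hY : ∀ y ∈ Y, ¬ cAdj i y (b, k))
    (h : Contractible i (subAdj i (hseg k a (b - 1) ∪ Y))) :
    Contractible i (subAdj i (hseg k a b ∪ Y)) := by
  rw [← insert_right_hseg hab.le, Set.insert_union]
  refine contractible_insert (q := (b - 1, k)) (Or.inl ?_) ?_ ?_ h
  · simp only [hseg, Set.mem_ofPred_eq, true_and]
    omega
  · rw [cAdj_of_snd_eq (by rfl)]
    dsimp only
    omega
  · rintro z (hz | hz) hza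
    · obtain ⟨h1, h2, h3⟩ := hz
      rw [cAdj_of_snd_eq h1] at hza ⊢
      dsimp only at *
      omega
    · exact absurd hza (hY z hz)

theorem contractible_hseg {i : ℕ} (k a : ℤ) (n : ℕ) :
    Contractible i (subAdj i (hseg k a (a + n))) := by
  induction n generalizing a with
  | zero =>
    refine ⟨⟨(a, k), rfl, le_refl a, by simp⟩, 0, fun x _ => x, fun _ => rfl, ?_, ?_⟩
    · rintro ⟨⟨x, y⟩, h1, h2, h3⟩
      dsimp only at h1 h2 h3
      exact Subtype.ext (Prod.ext (by dsimp only [id]; omega) h1)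
    · rintro ⟨⟨x, y⟩, h1, h2, h3⟩ ⟨⟨x', y'⟩, h1', h2', h3'⟩ s t - - -
      dsimp only at h1 h2 h3 h1' h2' h3'
      change cAdj i (x, y) (x', y')
      rw [cAdj_of_snd_eq (h1.trans h1'.symm)]
      dsimp only
      omega
  | succ n ih =>
    rw [← Set.union_empty (hseg _ _ _)]
    refine contractible_hseg_union_of_left (by omega) (by simp) ?_
    rw [Set.union_empty]
    have h := ih (a + 1)
    rwa [show a + 1 + (n : ℤ) = a + (n + 1 : ℕ) by push_cast; ring] at h

/-- A segment whose two endpoints are adjacent to a segment of a neighbouring row, and which has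
no other neighbours, can be pushed onto that row. -/
theorem contractible_hseg_union_of_push {i : ℕ} (hi : i = 1 ∨ i = 2) {k a b k' c d : ℤ}
    {Y : Set Pt} (hk : k' = k + 1 ∨ k' = k - 1) (hcd : c ≤ d) (hsY : hseg k' c d ⊆ Y)
    (hY : ∀ y ∈ Y, ∀ x ∈ hseg k a b, cAdj i y x → y ∈ hseg k' c d)
    (hcl : ∀ x ∈ hseg k a b, cAdj i x (max c (min d x.1), k'))
    (h : Contractible i (subAdj i Y)) : Contractible i (subAdj i (hseg k a b ∪ Y)) := by
  classical
  have hdisj : ∀ x ∈ Y, x ∉ hseg k a b := fun x hx hx' => by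
    have h1 := hY x hx x hx' (cAdj_refl_s9 x)
    have h2 := h1.1
    have h3 := hx'.1
    omega
  set f : Pt → Pt := fun x => if x ∈ Y then x else (max c (min d x.1), k')
  have fY : ∀ x ∈ Y, f x = x := fun x hx => if_pos hx
  have fr : ∀ x ∈ hseg k a b, f x = (max c (min d x.1), k') :=
    fun x hx => if_neg fun hx' => hdisj x hx' hx
  have hmix : ∀ x ∈ hseg k a b, ∀ y ∈ Y, cAdj i y x → cAdj i y (f x) := by
    intro x hx y hy hyx
    rw [fr x hx]
    have hys := hY y hy x hx hyx
    obtain ⟨h1, h2, h3⟩ := hys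
    rw [cAdj_of_snd_eq h1]
    obtain ⟨h4, h5, h6⟩ := hx
    rcases hi with rfl | rfl
    · rw [cAdj_one_iff_s9] at hyx
      dsimp only
      omega
    · rw [cAdj_two_iff] at hyx
      dsimp only
      omega
  refine contractible_of_step (Set.subset_union_right) f ?_ ?_ ?_ ?_ h
  · rintro x (hx | hx)
    · rw [fr x hx]
      refine hsY ⟨rfl, ?_⟩
      dsimp only
      omega
    · rwa [fY x hx]
  · rintro x (hx | hx) y (hy | hy) hxy
    · rw [fr x hx, fr y hy, cAdj_of_snd_eq (by rfl)]
      rw [cAdj_of_snd_eq (hx.1.trans hy.1.symm)] at hxy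
      dsimp only
      omega
    · rw [fY y hy]
      exact cAdj_symm_s9 (hmix x hx y hy (cAdj_symm_s9 hxy))
    · rw [fY x hx]
      exact hmix y hy x hx hxy
    · rwa [fY x hx, fY y hy]
  · rintro x (hx | hx)
    · rw [fr x hx]
      exact hcl x hx
    · rw [fY x hx]
      exact cAdj_refl_s9 x
  · intro hi1
    obtain rfl : i = 2 := hi.resolve_left hi1
    rintro x (hx | hx) y (hy | hy) hxy
    · have h1 := hcl x hx
      have h2 := hcl y hy
      rw [fr y hy]
      have h3 := hx.1
      have h4 := hy.1
      rw [cAdj_two_iff] at *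
      dsimp only at *
      omega
    · rwa [fY y hy]
    · exact hmix y hy x hx hxy
    · rwa [fY y hy]

/-- A segment all of whose neighbours lie in one segment of a neighbouring row can be removed. -/
theorem contractible_hseg_union {i : ℕ} (hi : i = 1 ∨ i = 2) {k k' c d : ℤ}
    {Y : Set Pt} (hk : k' = k + 1 ∨ k' = k - 1) (hcd : c ≤ d) (hsY : hseg k' c d ⊆ Y)
    (hcon : Contractible i (subAdj i Y)) (n : ℕ) (a b : ℤ) (hn : b = a + n)
    (hY : ∀ y ∈ Y, ∀ x ∈ hseg k a b, cAdj i y x → y ∈ hseg k' c d)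
    (hadj : ∃ x ∈ hseg k a b, ∃ y ∈ hseg k' c d, cAdj i x y) :
    Contractible i (subAdj i (hseg k a b ∪ Y)) := by
  induction n generalizing a b with
  | zero =>
    refine contractible_hseg_union_of_push hi hk hcd hsY hY ?_ hcon
    obtain ⟨x, ⟨h1, h2, h3⟩, y, ⟨h4, h5, h6⟩, h⟩ := hadj
    rintro x' ⟨h1', h2', h3'⟩
    rcases hi with rfl | rfl
    · rw [cAdj_one_iff_s9] at *
      dsimp only
      omega
    · rw [cAdj_two_iff] at *
      dsimp only
      omega
  | succ n ih =>
    obtain ⟨x, ⟨h1, h2, h3⟩, y, hy, h⟩ := hadj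
    by_cases ha : ∃ y ∈ hseg k' c d, cAdj i y (a, k)
    · by_cases hb : ∃ y ∈ hseg k' c d, cAdj i y (b, k)
      · refine contractible_hseg_union_of_push hi hk hcd hsY hY ?_ hcon
        obtain ⟨u, ⟨hu1, hu2, hu3⟩, hu⟩ := ha
        obtain ⟨v, ⟨hv1, hv2, hv3⟩, hv⟩ := hb
        rintro x' ⟨h1', h2', h3'⟩
        rcases hi with rfl | rfl
        · rw [cAdj_one_iff_s9] at *
          dsimp only at *
          omega
        · rw [cAdj_two_iff] at *
          dsimp only at *
          omega
      · have hb' : ∀ y ∈ Y, ¬ cAdj i y (b, k) := fun y hy h =>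
          hb ⟨y, hY y hy _ ⟨rfl, by dsimp only; omega, le_refl b⟩ h, h⟩
        refine contractible_hseg_union_of_right (by omega) hb' (ih a (b - 1) (by omega) ?_ ?_)
        · exact fun y hy x hx => hY y hy x ⟨hx.1, hx.2.1, by have := hx.2.2; omega⟩
        · refine ⟨x, ⟨h1, h2, ?_⟩, y, hy, h⟩
          have hne : x.1 ≠ b := fun hxb => hb' y (hsY hy) (by
            rw [← hxb, ← h1]
            exact cAdj_symm_s9 h)
          omega
    · have ha' : ∀ y ∈ Y, ¬ cAdj i y (a, k) := fun y hy h =>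
        ha ⟨y, hY y hy _ ⟨rfl, le_refl a, by dsimp only; omega⟩ h, h⟩
      refine contractible_hseg_union_of_left (by omega) ha' (ih (a + 1) b (by omega) ?_ ?_)
      · exact fun y hy x hx => hY y hy x ⟨hx.1, by have := hx.2.1; omega, hx.2.2⟩
      · refine ⟨x, ⟨h1, ?_, h3⟩, y, hy, h⟩
        have hne : x.1 ≠ a := fun hxa => ha' y (hsY hy) (by
          rw [← hxa, ← h1]
          exact cAdj_symm_s9 h)
        omega

/-- A union of horizontal segments whose adjacencies form a finite tree is contractible. -/
theorem contractible_iUnion_of_isTree {i : ℕ} (hi : i = 1 ∨ i = 2) (n : ℕ) {V : Type} [Finite V]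
    (hn : Nat.card V = n) (G : SimpleGraph V) (hG : G.IsTree) (k a b : V → ℤ)
    (hab : ∀ v, a v ≤ b v)
    (hadj : ∀ v w, G.Adj v w →
      ∃ x ∈ hseg (k v) (a v) (b v), ∃ y ∈ hseg (k w) (a w) (b w), cAdj i x y)
    (hsep : ∀ v w, v ≠ w → ∀ x ∈ hseg (k v) (a v) (b v), ∀ y ∈ hseg (k w) (a w) (b w),
      cAdj i x y → G.Adj v w ∧ k v ≠ k w) :
    Contractible i (subAdj i (⋃ v, hseg (k v) (a v) (b v))) := by
  classical
  induction n generalizing V with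
  | zero =>
    have := hG.connected.nonempty
    exact absurd hn Nat.card_pos.ne'
  | succ n ih =>
    have := Fintype.ofFinite V
    rcases subsingleton_or_nontrivial V with hV | hV
    · obtain ⟨v⟩ := hG.connected.nonempty
      have hU : (⋃ w, hseg (k w) (a w) (b w)) = hseg (k v) (a v) (b v) := by
        ext x
        simp only [Set.mem_iUnion]
        exact ⟨fun ⟨w, hw⟩ => Subsingleton.elim w v ▸ hw, fun h => ⟨v, h⟩⟩
      rw [hU]
      have h := contractible_hseg (i := i) (k v) (a v) (b v - a v).toNat
      rwa [show a v + ((b v - a v).toNat : ℤ) = b v by have := hab v; omega] at h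
    · obtain ⟨v, hv⟩ := hG.exists_vert_degree_one_of_nontrivial
      obtain ⟨w, hvw, hw⟩ := SimpleGraph.degree_eq_one_iff_existsUnique_adj.mp hv
      have htree : (G.induce {v}ᶜ).IsTree :=
        ⟨hG.connected.induce_compl_singleton_of_degree_eq_one hv, hG.isAcyclic.induce _⟩
      have hcard : Nat.card ({v}ᶜ : Set V) = n := by
        rw [Nat.card_coe_set_eq, Set.ncard_compl, Set.ncard_singleton, hn, Nat.add_sub_cancel]
      have hcon := ih hcard _ htree (fun u => k u) (fun u => a u) (fun u => b u)
        (fun u => hab u) (fun u u' h => hadj u u' h)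
        (fun u u' h => hsep u u' fun h' => h (Subtype.ext h'))
      have hU : (⋃ u, hseg (k u) (a u) (b u)) = hseg (k v) (a v) (b v) ∪
          ⋃ u : ({v}ᶜ : Set V), hseg (k u) (a u) (b u) := by
        ext x
        simp only [Set.mem_iUnion, Set.mem_union, Subtype.exists, Set.mem_compl_iff,
          Set.mem_singleton_iff, exists_prop]
        constructor
        · rintro ⟨u, hu⟩
          by_cases huv : u = v
          · exact Or.inl (huv ▸ hu)
          · exact Or.inr ⟨u, huv, hu⟩
        · rintro (h | ⟨u, -, hu⟩)
          exacts [⟨v, h⟩, ⟨u, hu⟩]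
      rw [hU]
      obtain ⟨x, hx, y, hy, hxy⟩ := hadj v w hvw
      have hkne := (hsep v w hvw.ne x hx y hy hxy).2
      refine contractible_hseg_union hi (k' := k w) (c := a w) (d := b w) ?_ (hab w) ?_ hcon
        (b v - a v).toNat _ _ ?_ ?_ ⟨x, hx, y, hy, hxy⟩
      · have h1 := hx.1
        have h2 := hy.1
        rcases hi with rfl | rfl
        · rw [cAdj_one_iff_s9] at hxy
          omega
        · rw [cAdj_two_iff] at hxy
          omega
      · exact fun z hz => Set.mem_iUnion.mpr ⟨⟨w, hvw.ne'⟩, hz⟩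
      · have := hab v
        omega
      · intro z hz z' hz' hzz
        obtain ⟨⟨u, hu⟩, hz⟩ := Set.mem_iUnion.mp hz
        have hvu := (hsep v u (fun h => hu h.symm) z' hz' z hz (cAdj_symm_s9 hzz)).1
        rwa [← hw u hvu]

theorem chainIn_iff {i : ℕ} {A : Set Pt} {x y : Pt} : ChainIn i A x y ↔
    x ∈ A ∧ Relation.ReflTransGen (fun u v => u ∈ A ∧ v ∈ A ∧ cAdj i u v) x y := by
  constructor
  · rintro ⟨n, c, rfl, rfl, hA, hc⟩
    refine ⟨hA 0 (Nat.zero_le _), ?_⟩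
    induction n with
    | zero => exact .refl
    | succ n ih =>
      exact (ih (fun k hk => hA k (by omega)) fun k hk => hc k (by omega)).tail
        ⟨hA n (by omega), hA _ le_rfl, hc n (by omega)⟩
  · rintro ⟨hx, h⟩
    induction h with
    | refl => exact ⟨0, fun _ => x, rfl, rfl, fun _ _ => hx, fun _ h => absurd h (by omega)⟩
    | @tail u v _ huv ih =>
      obtain ⟨n, c, h0, hn, hA, hc⟩ := ih
      refine ⟨n + 1, fun k => if k ≤ n then c k else v, by simpa using h0, by simp, ?_, ?_⟩
      · intro k _
        dsimp only
        split_ifs with hk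
        exacts [hA k hk, huv.2.1]
      · intro k hk
        rcases Nat.lt_succ_iff_lt_or_eq.mp hk with hk' | rfl
        · simpa [hk'.le, Nat.succ_le_of_lt hk'] using hc k hk'
        · simpa [hn] using huv.2.2

theorem ChainIn.mem_left {i : ℕ} {A : Set Pt} {x y : Pt} (h : ChainIn i A x y) : x ∈ A :=
  (chainIn_iff.mp h).1

theorem ChainIn.mem_right {i : ℕ} {A : Set Pt} {x y : Pt} (h : ChainIn i A x y) : y ∈ A := by
  obtain ⟨n, c, -, rfl, hA, -⟩ := h
  exact hA n le_rfl

theorem ChainIn.trans {i : ℕ} {A : Set Pt} {x y z : Pt} (h : ChainIn i A x y)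
    (h' : ChainIn i A y z) : ChainIn i A x z := by
  rw [chainIn_iff] at *
  exact ⟨h.1, h.2.trans h'.2⟩

theorem ChainIn.symm {i : ℕ} {A : Set Pt} {x y : Pt} (h : ChainIn i A x y) : ChainIn i A y x :=
  have : Std.Symm fun u v => u ∈ A ∧ v ∈ A ∧ cAdj i u v :=
    ⟨fun _ _ h => ⟨h.2.1, h.1, cAdj_symm_s9 h.2.2⟩⟩
  chainIn_iff.mpr ⟨h.mem_right, Relation.ReflTransGen.stdSymm.symm _ _ (chainIn_iff.mp h).2⟩

theorem chainIn_of_cAdj {i : ℕ} {A : Set Pt} {x y : Pt} (hx : x ∈ A) (hy : y ∈ A)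
    (h : cAdj i x y) : ChainIn i A x y :=
  chainIn_iff.mpr ⟨hx, .single ⟨hx, hy, h⟩⟩

theorem ChainIn.compOf_eq {i : ℕ} {A : Set Pt} {x y : Pt} (h : ChainIn i A x y) :
    compOf i A x = compOf i A y :=
  Set.ext fun _ => ⟨h.symm.trans, h.trans⟩

/-- A chain inside a row passes through every intermediate point. -/
theorem ChainIn.between {i : ℕ} {X : Set Pt} {k : ℤ} {x y : Pt} (h : ChainIn i (rowOf X k) x y)
    {z : ℤ} (hz : (x.1 ≤ z ∧ z ≤ y.1) ∨ (y.1 ≤ z ∧ z ≤ x.1)) :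
    ChainIn i (rowOf X k) x (z, k) := by
  obtain ⟨hx, h⟩ := chainIn_iff.mp h
  induction h with
  | refl =>
    have : ((z, k) : Pt) = x := Prod.ext (by dsimp only; omega) hx.2.symm
    rw [this]
    exact chainIn_of_cAdj hx hx (cAdj_refl_s9 x)
  | @tail u v hu huv ih =>
    have huv' := huv.2.2
    rw [cAdj_of_snd_eq (huv.1.2.trans huv.2.1.2.symm)] at huv'
    by_cases hzv : z = v.1
    · have : ((z, k) : Pt) = v := Prod.ext hzv huv.2.1.2.symm
      rw [this]
      exact chainIn_iff.mpr ⟨hx, hu.tail huv⟩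
    · exact ih (chainIn_iff.mpr ⟨hx, hu⟩) (by omega)

/-- Every row component of a finite image is a horizontal segment. -/
theorem IsRowComp.exists_eq_hseg {i : ℕ} {X : Set Pt} (hX : X.Finite) {r : Set Pt}
    (hr : IsRowComp i X r) : ∃ k a b : ℤ, a ≤ b ∧ r = hseg k a b := by
  obtain ⟨k, p, hp, rfl⟩ := hr
  have hsub : compOf i (rowOf X k) p ⊆ X := fun y hy => (ChainIn.mem_right hy).1
  have hfin := hX.subset hsub
  have hne : (compOf i (rowOf X k) p).Nonempty := ⟨p, chainIn_of_cAdj hp hp (cAdj_refl_s9 p)⟩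
  obtain ⟨u, hu, humin⟩ := Set.exists_min_image _ Prod.fst hfin hne
  obtain ⟨v, hv, hvmax⟩ := Set.exists_max_image _ Prod.fst hfin hne
  refine ⟨k, u.1, v.1, humin v hv, Set.ext fun z => ⟨fun hz =>
    ⟨(ChainIn.mem_right hz).2, humin z hz, hvmax z hz⟩, fun hz => ?_⟩⟩
  have hz' : ((z.1, k) : Pt) = z := Prod.ext rfl hz.1.symm
  have huz := ((ChainIn.symm hu).trans hv).between (Or.inl hz.2)
  rw [hz'] at huz
  exact ChainIn.trans hu huz

theorem IsRowComp.subset {i : ℕ} {X r : Set Pt} (hr : IsRowComp i X r) : r ⊆ X := by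
  obtain ⟨k, p, hp, rfl⟩ := hr
  exact fun y hy => (ChainIn.mem_right hy).1

/-- Row components with adjacent points on the same height coincide. -/
theorem IsRowComp.eq_of_cAdj {i : ℕ} {X r s : Set Pt} (hr : IsRowComp i X r)
    (hs : IsRowComp i X s) {x y : Pt} (hx : x ∈ r) (hy : y ∈ s) (hxy : cAdj i x y)
    (h : x.2 = y.2) : r = s := by
  obtain ⟨k, p, hp, rfl⟩ := hr
  obtain ⟨l, q, hq, rfl⟩ := hs
  have hxk := (ChainIn.mem_right hx).2
  have hyl := (ChainIn.mem_right hy).2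
  obtain rfl : k = l := hxk.symm.trans (h.trans hyl)
  exact (ChainIn.trans (ChainIn.trans hx (chainIn_of_cAdj (ChainIn.mem_right hx)
    (ChainIn.mem_right hy) hxy)) (ChainIn.symm hy)).compOf_eq

theorem isRowComp_compOf {i : ℕ} {X : Set Pt} {p : Pt} (hp : p ∈ X) :
    IsRowComp i X (compOf i (rowOf X p.2) p) :=
  ⟨p.2, p, ⟨hp, rfl⟩, rfl⟩

theorem mem_compOf_rowOf {i : ℕ} {X : Set Pt} {p : Pt} (hp : p ∈ X) :
    p ∈ compOf i (rowOf X p.2) p :=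
  chainIn_of_cAdj ⟨hp, rfl⟩ ⟨hp, rfl⟩ (cAdj_refl_s9 p)

/-- The row component graph as a simple graph on the row components. -/
def rowCompGraph (i : ℕ) (X : Set Pt) : SimpleGraph {r : Set Pt // IsRowComp i X r} where
  Adj r s := rcgAdj i X r s
  symm := ⟨fun _ _ ⟨hr, hs, hne, x, hx, y, hy, h⟩ =>
    ⟨hs, hr, hne.symm, y, hy, x, hx, cAdj_symm_s9 h⟩⟩
  loopless := ⟨fun _ h => h.2.2.1 rfl⟩

theorem rowCompGraph_connected {i : ℕ} {X : Set Pt} (hne : X.Nonempty)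
    (hconn : RCGConnected i X) : (rowCompGraph i X).Connected := by
  obtain ⟨p, hp⟩ := hne
  refine (SimpleGraph.connected_iff _).mpr ⟨fun r s => ?_, ⟨_, isRowComp_compOf hp⟩⟩
  obtain ⟨r, hr⟩ := r
  obtain ⟨s, hs⟩ := s
  have h := hconn r s hr hs
  induction h with
  | refl => exact .refl _
  | tail _ huv ih =>
    exact (ih huv.1).trans (SimpleGraph.Adj.reachable (G := rowCompGraph i X) huv)

theorem rowCompGraph_isAcyclic {i : ℕ} {X : Set Pt} (hacyc : RCGAcyclic i X) :
    (rowCompGraph i X).IsAcyclic := by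
  intro v c hc
  have hlen := hc.three_le_length
  refine hacyc ⟨c.length, fun t => (c.getVert t).1, hlen, fun t _ => (c.getVert t).2, ?_, ?_, ?_⟩
  · intro t ht t' ht' h
    exact hc.getVert_injOn' (by simp only [Set.mem_ofPred_eq]; omega)
      (by simp only [Set.mem_ofPred_eq]; omega) (Subtype.ext h)
  · exact fun t ht => c.adj_getVert_succ (by omega)
  · have h := c.adj_getVert_succ (i := c.length - 1) (by omega)
    rw [Nat.sub_add_cancel (by omega), c.getVert_length] at h
    simp only [SimpleGraph.Walk.getVert_zero]
    exact h

/-- if the row component graph `R(X,c_i)` is a tree (connected and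
acyclic), then `(X,c_i)` is `i`-contractible. -/
theorem stmt9 (i : ℕ) (hi : i = 1 ∨ i = 2) (X : Set Pt)
    (hX : X.Finite) (hne : X.Nonempty)
    (hconn : RCGConnected i X) (hacyc : RCGAcyclic i X) :
    Contractible i (subAdj i X) := by
  have hfin : Finite {r : Set Pt // IsRowComp i X r} :=
    (hX.finite_subsets.subset fun _ hr => IsRowComp.subset hr).to_subtype
  choose k a b hab heq using
    fun r : {r : Set Pt // IsRowComp i X r} => r.2.exists_eq_hseg hX
  have hU : X = ⋃ r, hseg (k r) (a r) (b r) := by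
    ext p
    simp only [Set.mem_iUnion, ← heq]
    exact ⟨fun hp => ⟨⟨_, isRowComp_compOf hp⟩, mem_compOf_rowOf hp⟩,
      fun ⟨r, hr⟩ => r.2.subset hr⟩
  have key := contractible_iUnion_of_isTree hi _ rfl (rowCompGraph i X)
    ⟨rowCompGraph_connected hne hconn, rowCompGraph_isAcyclic hacyc⟩ k a b hab ?_ ?_
  · rwa [← hU] at key
  · intro r s hrs
    rw [← heq, ← heq]
    exact hrs.2.2.2
  · intro r s hrs x hx y hy hxy
    have hxk := hx.1
    have hyk := hy.1
    rw [← heq] at hx hy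
    refine ⟨⟨r.2, s.2, fun h => hrs (Subtype.ext h), x, hx, y, hy, hxy⟩, fun h => ?_⟩
    exact hrs (Subtype.ext (r.2.eq_of_cAdj s.2 hx hy hxy (by omega)))
end
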